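/- Let G=(V, E_1 ∪ E_2) be biconnected with core H induced by E_1 and SPQR-tree 𝒯, and let μ be an S-node of 𝒯 with children ν_1, …, ν_h. If μ is traversable, then every child ν_i of μ is traversable. -/

import Mathlib

open Set

noncomputable section

/-- Points of the plane. -/
abbrev Pt : Type := ℝ × ℝ

/-- An edge set on the vertex type `V`: a set of ordered pairs of vertices. -/
abbrev EdgeSet (V : Type) := Set (V × V)

/-- The vertices incident to at least one edge of `F` (the vertex set of the
subgraph induced by `F`, isolated vertices being dropped). -/
def vertexSupport {V : Type} (F : EdgeSet V) : Set V :=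
  {v | ∃ e ∈ F, v = e.1 ∨ v = e.2}

/-- A drawing of the graph `(V, E)` in the plane: vertices are mapped to distinct
points, and every edge `e ∈ E` is drawn as a simple (Jordan) arc joining the
points of its two endpoints whose interior passes through no vertex point. -/
structure Drawing (V : Type) (E : EdgeSet V) where
  pos : V → Pt
  pos_inj : Function.Injective pos
  curve : V × V → ℝ → Pt
  curve_contOn : ∀ e ∈ E, ContinuousOn (curve e) (Set.Icc (0:ℝ) 1)
  curve_injOn : ∀ e ∈ E, Set.InjOn (curve e) (Set.Icc (0:ℝ) 1)
  curve_src : ∀ e ∈ E, curve e 0 = pos e.1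
  curve_tgt : ∀ e ∈ E, curve e 1 = pos e.2
  curve_avoids : ∀ e ∈ E, ∀ v : V, pos v ∉ curve e '' Set.Ioo (0:ℝ) 1

namespace Drawing

variable {V : Type} {E : EdgeSet V}

/-- The open arc drawn for an edge (excluding its endpoints). -/
def openArc (D : Drawing V E) (e : V × V) : Set Pt := D.curve e '' Set.Ioo (0:ℝ) 1

/-- The set of points of the plane covered by the drawing of the edges of `F`
(arcs together with their endpoints). -/
def image (D : Drawing V E) (F : EdgeSet V) : Set Pt :=
  ⋃ e ∈ F, D.curve e '' Set.Icc (0:ℝ) 1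

/-- The set of points covered by the interiors of the arcs of the edges of `F`. -/
def openImage (D : Drawing V E) (F : EdgeSet V) : Set Pt :=
  ⋃ e ∈ F, D.openArc e

/-- Two distinct edges cross if the interiors of their arcs share a point. -/
def Crosses (D : Drawing V E) (e e' : V × V) : Prop :=
  e ≠ e' ∧ (D.openArc e ∩ D.openArc e').Nonempty

/-- No two edges of `F` cross each other in the drawing. -/
def PlanarOn (D : Drawing V E) (F : EdgeSet V) : Prop :=
  ∀ e ∈ F, ∀ e' ∈ F, ¬ D.Crosses e e'

/-- A planar drawing: no two edges cross. -/
def Planar (D : Drawing V E) : Prop := D.PlanarOn E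

/-- `f` is a face of the sub-drawing induced by the edges of `F`: a connected
component of the complement of the drawn image of `F`. -/
def IsFaceOf (D : Drawing V E) (F : EdgeSet V) (f : Set Pt) : Prop :=
  ∃ p ∈ (D.image F)ᶜ, f = connectedComponentIn (D.image F)ᶜ p

/-- The outer face: the unbounded face. -/
def IsOuterFaceOf (D : Drawing V E) (F : EdgeSet V) (f : Set Pt) : Prop :=
  D.IsFaceOf F f ∧ ¬ Bornology.IsBounded f

/-- A vertex is incident to (lies on) a face if its point belongs to the
closure of the face. -/
def VertexOn (D : Drawing V E) (f : Set Pt) (v : V) : Prop :=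
  D.pos v ∈ closure f

/-- The drawing of the edges of `F` is contained in, or incident to, the
face `f`: the closure of `f` meets the interior of some arc of `F`. -/
def TouchesFace (D : Drawing V E) (F : EdgeSet V) (f : Set Pt) : Prop :=
  (closure f ∩ D.openImage F).Nonempty

/-- The restriction of a drawing to a smaller edge set (the drawing of a
subgraph). -/
def restrict (D : Drawing V E) (F : EdgeSet V) (h : F ⊆ E) : Drawing V F where
  pos := D.pos
  pos_inj := D.pos_inj
  curve := D.curve
  curve_contOn := fun e he => D.curve_contOn e (h he)
  curve_injOn := fun e he => D.curve_injOn e (h he)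
  curve_src := fun e he => D.curve_src e (h he)
  curve_tgt := fun e he => D.curve_tgt e (h he)
  curve_avoids := fun e he => D.curve_avoids e (h he)

end Drawing

/-- A crossing between edges `e` and `e'` is *forbidden* if it involves a
primary edge or two secondary edges. -/
def ForbiddenPair {V : Type} (Ep Es : EdgeSet V) (e e' : V × V) : Prop :=
  e ∈ Ep ∨ e' ∈ Ep ∨ (e ∈ Es ∧ e' ∈ Es)

/-- The drawing `D` of `G = (V, Ep ∪ Es ∪ Et)` has no forbidden crossing:
primary edges are crossing-free and secondary edges may only cross tertiary
edges. -/
def NoForbiddenCrossing {V : Type} (Ep Es Et : EdgeSet V)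
    (D : Drawing V (Ep ∪ Es ∪ Et)) : Prop :=
  ∀ e ∈ Ep ∪ Es ∪ Et, ∀ e' ∈ Ep ∪ Es ∪ Et,
    D.Crosses e e' → ¬ ForbiddenPair Ep Es e e'

/-- Hierarchical Partial Planarity: the graph `(V, Ep ∪ Es ∪ Et)` admits a
drawing with no forbidden crossing. -/
def HPPPositive (V : Type) (Ep Es Et : EdgeSet V) : Prop :=
  ∃ D : Drawing V (Ep ∪ Es ∪ Et), NoForbiddenCrossing Ep Es Et D

/-- A solution of the Facial-Constrained Core Planarity instance
`⟨G = (V, E1 ∪ E2), W⟩`: a planar drawing of `G` such that for every pair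
`⟨u,v⟩ ∈ W` some face of the restriction to the core (the subgraph induced
by `E1`) contains both `u` and `v`. -/
def FCCPSolution {V : Type} (E1 E2 : EdgeSet V) (W : Set (V × V))
    (D : Drawing V (E1 ∪ E2)) : Prop :=
  D.Planar ∧ ∀ p ∈ W, ∃ f, D.IsFaceOf E1 f ∧ D.VertexOn f p.1 ∧ D.VertexOn f p.2

/-- Facial-Constrained Core Planarity. -/
def FCCPPositive (V : Type) (E1 E2 : EdgeSet V) (W : Set (V × V)) : Prop :=
  ∃ D : Drawing V (E1 ∪ E2), FCCPSolution E1 E2 W D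

/-- The simple graph induced by an edge set. -/
def graphOf {V : Type} (F : EdgeSet V) : SimpleGraph V :=
  SimpleGraph.fromRel (fun a b => (a, b) ∈ F)

/-- The graph induced by the edge set `F` is biconnected: removing any single
vertex leaves it connected. -/
def Biconnected {V : Type} (F : EdgeSet V) : Prop :=
  ∀ x : V, ((graphOf F).induce {v | v ∈ vertexSupport F ∧ v ≠ x}).Connected

/-- A simple path from `u` to `v` all of whose edges belong to `F`. -/
structure CorePath {V : Type} (F : EdgeSet V) (u v : V) where
  len : ℕ
  vtx : Fin (len + 1) → V
  vtx_inj : Function.Injective vtx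
  src : vtx 0 = u
  tgt : vtx (Fin.last len) = v
  edge_mem : ∀ i : Fin len,
    (vtx i.castSucc, vtx i.succ) ∈ F ∨ (vtx i.succ, vtx i.castSucc) ∈ F

/-- A simple cycle through `u` and `v` all of whose edges belong to `F`. -/
structure CoreCycle {V : Type} (F : EdgeSet V) (u v : V) where
  len : ℕ
  len_ge : 3 ≤ len
  vtx : ZMod len → V
  vtx_inj : Function.Injective vtx
  mem_u : u ∈ Set.range vtx
  mem_v : v ∈ Set.range vtx
  edge_mem : ∀ i : ZMod len, (vtx i, vtx (i + 1)) ∈ F ∨ (vtx (i + 1), vtx i) ∈ F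

/-- The set of edges used by a cycle. -/
def CoreCycle.edgeSet {V : Type} {F : EdgeSet V} {u v : V}
    (C : CoreCycle F u v) : EdgeSet V :=
  {p | p ∈ F ∧ ∃ i : ZMod C.len,
    p = (C.vtx i, C.vtx (i + 1)) ∨ p = (C.vtx (i + 1), C.vtx i)}

/-- The four kinds of nodes of an SPQR-tree. -/
inductive SPQRType : Type
  | S | P | Q | R
deriving DecidableEq

/-- An (abstract) SPQR-tree of the biconnected graph `(V, E)`: the tree of its
triconnected components.  Every node has two poles (the endvertices of its
reference edge), a pertinent graph (a subgraph of `G` given by its edge set),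
a type, and a set of children. -/
structure SPQRTree (V : Type) (E : EdgeSet V) where
  Node : Type
  root : Node
  pert : Node → EdgeSet V
  pole1 : Node → V
  pole2 : Node → V
  poles_ne : ∀ μ, pole1 μ ≠ pole2 μ
  pert_sub : ∀ μ, pert μ ⊆ E
  pert_root : pert root = E
  nodeType : Node → SPQRType
  children : Node → Set Node
  child_pert_sub : ∀ {μ ν}, ν ∈ children μ → pert ν ⊆ pert μ
  child_pert_disj : ∀ {μ ν ν'}, ν ∈ children μ → ν' ∈ children μ → ν ≠ ν' →
    Disjoint (pert ν) (pert ν')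
  pert_union : ∀ μ, nodeType μ ≠ SPQRType.Q → pert μ = ⋃ ν ∈ children μ, pert ν
  /-- the pertinent graph meets the rest of the graph only at the poles -/
  sep_poles : ∀ μ,
    vertexSupport (pert μ) ∩ vertexSupport (E \ pert μ) ⊆ {pole1 μ, pole2 μ}
  /-- the skeleton of an S-node is a simple cycle: its children are arranged
  in a path between the two poles -/
  snode_cycle : ∀ μ, nodeType μ = SPQRType.S →
    ∃ (h : ℕ) (w : Fin (h + 1) → V) (cs : Fin h → Node),
      2 ≤ h ∧ Function.Injective w ∧ w 0 = pole1 μ ∧ w (Fin.last h) = pole2 μ ∧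
      Function.Injective cs ∧ children μ = Set.range cs ∧
      ∀ i : Fin h, ({pole1 (cs i), pole2 (cs i)} : Set V) = {w i.castSucc, w i.succ}
  /-- the skeleton of a P-node is a bundle of parallel edges: all children
  share the poles of the node, and there are at least two of them -/
  pnode_poles : ∀ μ, nodeType μ = SPQRType.P →
    (∀ ν ∈ children μ, ({pole1 ν, pole2 ν} : Set V) = ({pole1 μ, pole2 μ} : Set V)) ∧
    ∃ ν ν', ν ∈ children μ ∧ ν' ∈ children μ ∧ ν ≠ ν'

/-- A node `μ` is non-traversable (w.r.t. the core edge set `E1`) if there is a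
cycle composed of edges of `E1` containing both poles of `μ`, at least one
edge of `pert μ`, and at least one edge of `G \ pert μ`. -/
def NodeNonTraversable {V : Type} {E : EdgeSet V} (E1 : EdgeSet V)
    (T : SPQRTree V E) (μ : T.Node) : Prop :=
  ∃ C : CoreCycle E1 (T.pole1 μ) (T.pole2 μ),
    (C.edgeSet ∩ T.pert μ).Nonempty ∧ (C.edgeSet \ T.pert μ).Nonempty

/-- A node is traversable if it is not non-traversable. -/
def NodeTraversable {V : Type} {E : EdgeSet V} (E1 : EdgeSet V)
    (T : SPQRTree V E) (μ : T.Node) : Prop :=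
  ¬ NodeNonTraversable E1 T μ

/-- The edges of `G` represented by the graph `H^skel_μ`: the core edges in the
pertinent graphs of the non-traversable children of `μ`, together with (when
`μ` itself is non-traversable) the core edges of `G \ pert μ` (represented by
the reference edge of `μ`). -/
def HskelEdges {V : Type} {E : EdgeSet V} (E1 : EdgeSet V)
    (T : SPQRTree V E) (μ : T.Node) : EdgeSet V :=
  {e | e ∈ E1 ∧ ((∃ ν ∈ T.children μ, NodeNonTraversable E1 T ν ∧ e ∈ T.pert ν) ∨
      (NodeNonTraversable E1 T μ ∧ e ∈ E ∧ e ∉ T.pert μ))}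

/-- `C` is the component represented by the virtual edge `e^y` of `skel μ`
containing the vertex `y`: either the pertinent graph of a child `ν_j ≠ ν_i`
of `μ`, or the rest of the graph `G \ pert μ` (represented by `ref μ`). -/
def CompOfSpec {V : Type} {E : EdgeSet V} (T : SPQRTree V E) (μ νi : T.Node)
    (y : V) (C : EdgeSet V) : Prop :=
  (∃ νj ∈ T.children μ, νj ≠ νi ∧ y ∈ vertexSupport (T.pert νj) ∧ C = T.pert νj) ∨
  (y ∉ vertexSupport (T.pert μ) ∧ C = E \ T.pert μ)

/-- `c` is one of the components of `G` represented by the virtual edges of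
`H^skel_μ`. -/
def IsVirtualComp {V : Type} {E : EdgeSet V} (E1 : EdgeSet V)
    (T : SPQRTree V E) (μ : T.Node) (c : EdgeSet V) : Prop :=
  (∃ ν ∈ T.children μ, NodeNonTraversable E1 T ν ∧ c = T.pert ν) ∨
  (NodeNonTraversable E1 T μ ∧ c = E \ T.pert μ)

/-- The vertex set of the component of `G` corresponding to a vertex of the
auxiliary graph `G_aux` of a P-node `μ`: `some ν` stands for a child `ν` of
`μ` and `none` stands for `ref μ`, i.e. `G \ pert μ`. -/
def compVerts {V : Type} {E : EdgeSet V} (T : SPQRTree V E) (μ : T.Node) :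
    Option T.Node → Set V
  | some ν => vertexSupport (T.pert ν)
  | none => vertexSupport (E \ T.pert μ)

/-- A black vertex of `G_aux`: a non-traversable child, or `ref μ` when `μ` is
non-traversable. -/
def IsBlackComp {V : Type} {E : EdgeSet V} (E1 : EdgeSet V) (T : SPQRTree V E)
    (μ : T.Node) : Option T.Node → Prop
  | some ν => ν ∈ T.children μ ∧ NodeNonTraversable E1 T ν
  | none => NodeNonTraversable E1 T μ

/-- A white vertex of `G_aux`: a traversable child, or `ref μ` when `μ` is
traversable. -/
def IsWhiteComp {V : Type} {E : EdgeSet V} (E1 : EdgeSet V) (T : SPQRTree V E)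
    (μ : T.Node) : Option T.Node → Prop
  | some ν => ν ∈ T.children μ ∧ NodeTraversable E1 T ν
  | none => NodeTraversable E1 T μ

/-- Two vertices of `G_aux` are linked if some pair of `W` has one member in
each of the two corresponding components. -/
def linked {V : Type} {E : EdgeSet V} (T : SPQRTree V E) (μ : T.Node)
    (W : Set (V × V)) (c c' : Option T.Node) : Prop :=
  ∃ p ∈ W, (p.1 ∈ compVerts T μ c ∧ p.2 ∈ compVerts T μ c') ∨
           (p.1 ∈ compVerts T μ c' ∧ p.2 ∈ compVerts T μ c)

/-- Two white vertices belong to the same contracted white cluster of `G_aux`. -/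
def whiteConn {V : Type} {E : EdgeSet V} (E1 : EdgeSet V) (T : SPQRTree V E)
    (μ : T.Node) (W : Set (V × V)) : Option T.Node → Option T.Node → Prop :=
  Relation.ReflTransGen
    (fun a b => IsWhiteComp E1 T μ a ∧ IsWhiteComp E1 T μ b ∧ linked T μ W a b)

/-- Adjacency between black vertices in the reduced auxiliary graph
`Ḡ_aux`: a direct link, or a link through a (contracted) chain of
degree-two white vertices. -/
def blackAdjRel {V : Type} {E : EdgeSet V} (E1 : EdgeSet V) (T : SPQRTree V E)
    (μ : T.Node) (W : Set (V × V)) (b b' : Option T.Node) : Prop :=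
  IsBlackComp E1 T μ b ∧ IsBlackComp E1 T μ b' ∧ b ≠ b' ∧
    (linked T μ W b b' ∨
      ∃ w w', IsWhiteComp E1 T μ w ∧ IsWhiteComp E1 T μ w' ∧
        linked T μ W b w ∧ whiteConn E1 T μ W w w' ∧ linked T μ W w' b')

/-- The reduced auxiliary graph `Ḡ_aux` on the black vertices. -/
def auxGraph {V : Type} {E : EdgeSet V} (E1 : EdgeSet V) (T : SPQRTree V E)
    (μ : T.Node) (W : Set (V × V)) :
    SimpleGraph {c : Option T.Node // IsBlackComp E1 T μ c} :=
  SimpleGraph.fromRel (fun a b => blackAdjRel E1 T μ W a.1 b.1)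

/-- A graph is either a single cycle through all its vertices or a
vertex-disjoint collection of paths (possibly single vertices): every vertex
has degree at most two, and the graph is acyclic or connected and 2-regular. -/
def IsCycleOrPaths {α : Type} (G : SimpleGraph α) : Prop :=
  (∀ v a b c : α, G.Adj v a → G.Adj v b → G.Adj v c → a = b ∨ a = c ∨ b = c) ∧
  (G.IsAcyclic ∨ (G.Connected ∧ ∀ v : α, ∃ a b, a ≠ b ∧ G.Adj v a ∧ G.Adj v b))

/-- The bags of a node: a special bag together with a family of bags each
consisting of two pockets. -/
structure Bags (V : Type) where
  special : Set V
  ι : Type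
  pocketS : ι → Set V
  pocketT : ι → Set V

/-- Requirement R.1 for a drawing of `pert μ` (with edge set `F`): every pair
of `W` whose two members belong to `pert μ` shares a face of the restriction
to the core. -/
def SatisfiesR1 {V : Type} {F : EdgeSet V} (E1 : EdgeSet V) (W : Set (V × V))
    (D : Drawing V F) : Prop :=
  ∀ p ∈ W, p.1 ∈ vertexSupport F → p.2 ∈ vertexSupport F →
    ∃ f, D.IsFaceOf (E1 ∩ F) f ∧ D.VertexOn f p.1 ∧ D.VertexOn f p.2

/-- Requirement R.2 for a drawing of `pert μ` (with edge set `F`): for every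
pair of `W` with exactly one member in `pert μ`, that member lies on the outer
face of the restriction to the core. -/
def SatisfiesR2 {V : Type} {F : EdgeSet V} (E1 : EdgeSet V) (W : Set (V × V))
    (D : Drawing V F) : Prop :=
  ∀ p ∈ W, p.1 ∈ vertexSupport F → p.2 ∉ vertexSupport F →
    ∃ f, D.IsOuterFaceOf (E1 ∩ F) f ∧ D.VertexOn f p.1

/-- A drawing of `pert μ` is described by the bags `B`: there are two faces
`f_l`, `f_r` of the restriction to the core such that every vertex of the
special bag is incident to both, and for every bag its two pockets are
incident to `f_l` and `f_r` respectively, up to a flip. -/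
def DescribedBy {V : Type} {F : EdgeSet V} (E1 : EdgeSet V) (D : Drawing V F)
    (B : Bags V) : Prop :=
  ∃ fl fr, D.IsFaceOf (E1 ∩ F) fl ∧ D.IsFaceOf (E1 ∩ F) fr ∧
    (∀ v ∈ B.special, D.VertexOn fl v ∧ D.VertexOn fr v) ∧
    ∀ i : B.ι,
      ((∀ v ∈ B.pocketS i, D.VertexOn fl v) ∧ (∀ v ∈ B.pocketT i, D.VertexOn fr v)) ∨
      ((∀ v ∈ B.pocketS i, D.VertexOn fr v) ∧ (∀ v ∈ B.pocketT i, D.VertexOn fl v))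

/-- Partial Planarity: `G = (V, E)` has a drawing in which no edge of `F` is
crossed. -/
def PPPositive (V : Type) (E F : EdgeSet V) : Prop :=
  ∃ D : Drawing V E, ∀ e ∈ F, ∀ e' ∈ E, ¬ D.Crosses e e'

/-- Partially-Embedded Planarity: the given planar drawing `DH` of the
subgraph with edge set `EH` extends to a planar drawing of the whole graph. -/
def PEPPositive {V : Type} (E EH : EdgeSet V) (DH : Drawing V EH) : Prop :=
  ∃ D : Drawing V E, D.Planar ∧ D.pos = DH.pos ∧ ∀ e ∈ EH, D.curve e = DH.curve e

/-- The vertices of `S` appear in the same cyclic order along the boundaries of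
`f` (w.r.t. the vertex placement `p`) and of `f'` (w.r.t. `q`): the two
boundaries can be parametrized by the circle so that each vertex of `S` is met
at the same parameter. -/
def SameFacialOrder {V : Type} (p q : V → Pt) (S : Set V) (f f' : Set Pt) : Prop :=
  ∃ γ γ' : AddCircle (1 : ℝ) → Pt,
    Continuous γ ∧ Continuous γ' ∧ Function.Injective γ ∧ Function.Injective γ' ∧
    Set.range γ = frontier f ∧ Set.range γ' = frontier f' ∧
    ∀ v ∈ S, ∃ t, γ t = p v ∧ γ' t = q v

end


/-- A proper nonempty subset of a finite cyclic group is left by some successor step. -/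
lemma ZMod.exists_mem_add_one_notMem {n : ℕ} [NeZero n] {A : Set (ZMod n)} {a b : ZMod n}
    (ha : a ∈ A) (hb : b ∉ A) : ∃ i ∈ A, i + 1 ∉ A := by
  by_contra! h
  have key : ∀ k : ℕ, a + k ∈ A := by
    intro k
    induction k with
    | zero => simpa using ha
    | succ k ih => simpa [add_assoc] using h _ ih
  apply hb
  simpa using key (b - a).val

namespace CoreCycle

variable {V : Type} {F : EdgeSet V} {u v : V}

lemma vtx_mem_vertexSupport {X : EdgeSet V} (C : CoreCycle F u v) {i : ZMod C.len}
    (h : (C.vtx i, C.vtx (i + 1)) ∈ X ∨ (C.vtx (i + 1), C.vtx i) ∈ X) :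
    C.vtx i ∈ vertexSupport X ∧ C.vtx (i + 1) ∈ vertexSupport X := by
  rcases h with h | h
  · exact ⟨⟨_, h, Or.inl rfl⟩, ⟨_, h, Or.inr rfl⟩⟩
  · exact ⟨⟨_, h, Or.inr rfl⟩, ⟨_, h, Or.inl rfl⟩⟩

/-- If a cycle has edges both inside and outside `X`, then it has at least two vertices incident
to both kinds of edges. -/
lemma exists_ne_mem_vertexSupport (C : CoreCycle F u v) {X : EdgeSet V}
    (hin : (C.edgeSet ∩ X).Nonempty) (hout : (C.edgeSet \ X).Nonempty) :
    ∃ a ∈ range C.vtx, ∃ b ∈ range C.vtx, a ≠ b ∧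
      (a ∈ vertexSupport (C.edgeSet ∩ X) ∧ a ∈ vertexSupport (C.edgeSet \ X)) ∧
      (b ∈ vertexSupport (C.edgeSet ∩ X) ∧ b ∈ vertexSupport (C.edgeSet \ X)) := by
  have hlen := C.len_ge
  have : NeZero C.len := ⟨by omega⟩
  have : Fact (1 < C.len) := ⟨by omega⟩
  let On (Y : EdgeSet V) : Set (ZMod C.len) :=
    {i | (C.vtx i, C.vtx (i + 1)) ∈ Y ∨ (C.vtx (i + 1), C.vtx i) ∈ Y}
  have hOn : ∀ Y : EdgeSet V, (C.edgeSet ∩ Y).Nonempty → (On (C.edgeSet ∩ Y)).Nonempty := by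
    rintro Y ⟨e, he, heY⟩
    obtain ⟨i, hi | hi⟩ := he.2
    · exact ⟨i, Or.inl (hi ▸ ⟨he, heY⟩)⟩
    · exact ⟨i, Or.inr (hi ▸ ⟨he, heY⟩)⟩
  have hcover : ∀ i, i ∉ On (C.edgeSet ∩ X) → i ∈ On (C.edgeSet \ X) := by
    intro i hi
    rcases C.edge_mem i with h | h
    · have he : (C.vtx i, C.vtx (i + 1)) ∈ C.edgeSet := ⟨h, i, Or.inl rfl⟩
      exact Or.inl ⟨he, fun hX => hi (Or.inl ⟨he, hX⟩)⟩
    · have he : (C.vtx (i + 1), C.vtx i) ∈ C.edgeSet := ⟨h, i, Or.inr rfl⟩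
      exact Or.inr ⟨he, fun hX => hi (Or.inr ⟨he, hX⟩)⟩
  obtain ⟨p, hp⟩ := hOn X hin
  obtain ⟨q, hq⟩ : (On (C.edgeSet \ X)).Nonempty := hOn Xᶜ hout
  by_cases hboth : ∃ i, i ∈ On (C.edgeSet ∩ X) ∧ i ∈ On (C.edgeSet \ X)
  · obtain ⟨i, hi, hi'⟩ := hboth
    have h := C.vtx_mem_vertexSupport hi
    have h' := C.vtx_mem_vertexSupport hi'
    exact ⟨_, mem_range_self i, _, mem_range_self (i + 1), C.vtx_inj.ne (by simp),
      ⟨h.1, h'.1⟩, ⟨h.2, h'.2⟩⟩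
  · push Not at hboth
    have hq' : q ∉ On (C.edgeSet ∩ X) := fun h => hboth q h hq
    obtain ⟨i, hi, hi1⟩ := ZMod.exists_mem_add_one_notMem hp hq'
    obtain ⟨j, hj, hj1⟩ := ZMod.exists_mem_add_one_notMem
      (A := (On (C.edgeSet ∩ X))ᶜ) hq' (not_not_intro hp)
    have hij : i + 1 ≠ j + 1 := fun h => hj (add_right_cancel h ▸ hi)
    exact ⟨_, mem_range_self (i + 1), _, mem_range_self (j + 1), C.vtx_inj.ne hij,
      ⟨(C.vtx_mem_vertexSupport hi).2, (C.vtx_mem_vertexSupport (hcover _ hi1)).1⟩,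
      ⟨(C.vtx_mem_vertexSupport (not_not.mp hj1)).1,
        (C.vtx_mem_vertexSupport (hcover _ hj)).2⟩⟩

end CoreCycle

lemma vertexSupport_mono {V : Type} {F F' : EdgeSet V} (h : F ⊆ F') :
    vertexSupport F ⊆ vertexSupport F' :=
  fun _ ⟨e, he, hv⟩ => ⟨e, h he, hv⟩

namespace SPQRTree

variable {V : Type} {E : EdgeSet V}

/-- A cycle of `G` with edges both inside and outside `pert μ` passes through both poles of `μ`. -/
lemma poles_mem_range_vtx (T : SPQRTree V E) {E1 : EdgeSet V} (hE : E1 ⊆ E) (μ : T.Node)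
    {u v : V} (C : CoreCycle E1 u v) (hin : (C.edgeSet ∩ T.pert μ).Nonempty)
    (hout : (C.edgeSet \ T.pert μ).Nonempty) :
    T.pole1 μ ∈ range C.vtx ∧ T.pole2 μ ∈ range C.vtx := by
  obtain ⟨a, ha, b, hb, hab, ha', hb'⟩ := C.exists_ne_mem_vertexSupport hin hout
  have hsub : C.edgeSet \ T.pert μ ⊆ E \ T.pert μ := fun e he => ⟨hE he.1.1, he.2⟩
  have hsep : ∀ x, x ∈ vertexSupport (C.edgeSet ∩ T.pert μ) ∧
      x ∈ vertexSupport (C.edgeSet \ T.pert μ) → x = T.pole1 μ ∨ x = T.pole2 μ :=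
    fun x hx => T.sep_poles μ
      ⟨vertexSupport_mono inter_subset_right hx.1, vertexSupport_mono hsub hx.2⟩
  rcases hsep a ha' with rfl | rfl <;> rcases hsep b hb' with rfl | rfl <;> simp_all

/-- Pertinent graphs of two distinct children can only share vertices that are poles of the
first one. -/
lemma mem_poles_of_mem_vertexSupport (T : SPQRTree V E) {μ ν ν' : T.Node}
    (hν : ν ∈ T.children μ) (hν' : ν' ∈ T.children μ) (hne : ν ≠ ν') {x : V}
    (hx : x ∈ vertexSupport (T.pert ν)) (hx' : x ∈ vertexSupport (T.pert ν')) :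
    x ∈ ({T.pole1 ν, T.pole2 ν} : Set V) := by
  have hsub : T.pert ν' ⊆ E \ T.pert ν := fun _ he =>
    ⟨T.pert_sub ν' he, fun h => disjoint_left.mp (T.child_pert_disj hν hν' hne) h he⟩
  exact T.sep_poles ν ⟨hx, vertexSupport_mono hsub hx'⟩

/-- A cycle contained in the pertinent graph of an S-node and using an edge of the pertinent graph
of one of its children is contained in the latter. -/
lemma edgeSet_subset_pert_child (T : SPQRTree V E) {μ : T.Node}
    (hS : T.nodeType μ = SPQRType.S) {E1 : EdgeSet V} {u v : V} (C : CoreCycle E1 u v)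
    (hC : C.edgeSet ⊆ T.pert μ) {ν : T.Node} (hν : ν ∈ T.children μ)
    (hin : (C.edgeSet ∩ T.pert ν).Nonempty) : C.edgeSet ⊆ T.pert ν := by
  obtain ⟨h, w, cs, -, hw, -, -, hcs, hch, hpoles⟩ := T.snode_cycle μ hS
  have hmem : ∀ i, cs i ∈ T.children μ := fun i => hch ▸ mem_range_self i
  have hcover : ∀ e ∈ C.edgeSet, ∃ i, e ∈ T.pert (cs i) := by
    intro e he
    have he' := hC he
    rw [T.pert_union μ (by simp [hS]), hch] at he'
    simpa using he'
  have hcut : ∀ i j : Fin h, i < j → (C.edgeSet ∩ T.pert (cs i)).Nonempty →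
      ¬ (C.edgeSet ∩ T.pert (cs j)).Nonempty := by
    rintro i j hij ⟨e, he, hei⟩ ⟨f, hf, hfj⟩
    let X : EdgeSet V := ⋃ k ∈ Iic i, T.pert (cs k)
    have hshared : ∀ x, x ∈ vertexSupport (C.edgeSet ∩ X) ∧
        x ∈ vertexSupport (C.edgeSet \ X) → x = w i.succ := by
      rintro x ⟨⟨e, ⟨-, heX⟩, hxe⟩, ⟨f, ⟨hf, hfX⟩, hxf⟩⟩
      obtain ⟨l, hl⟩ := hcover f hf
      simp only [X, mem_iUnion, mem_Iic, not_exists] at heX hfX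
      obtain ⟨k, hki, hk⟩ := heX
      have hil : i < l := lt_of_not_ge fun hli => hfX l hli hl
      have hkl : k ≠ l := by omega
      have h1 := T.mem_poles_of_mem_vertexSupport (hmem k) (hmem l) (hcs.ne hkl)
        ⟨e, hk, hxe⟩ ⟨f, hl, hxf⟩
      have h2 := T.mem_poles_of_mem_vertexSupport (hmem l) (hmem k) (hcs.ne hkl.symm)
        ⟨f, hl, hxf⟩ ⟨e, hk, hxe⟩
      rw [hpoles, mem_insert_iff, mem_singleton_iff] at h1 h2
      have hwidx : ∃ m, x = w m ∧ (m = k.castSucc ∨ m = k.succ) ∧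
          (m = l.castSucc ∨ m = l.succ) := by
        rcases h1 with h1 | h1 <;> rcases h2 with h2 | h2 <;>
          exact ⟨_, h1, by simp, by simp [hw (h1.symm.trans h2)]⟩
      obtain ⟨m, rfl, hmk, hml⟩ := hwidx
      congr 1
      simp only [Fin.ext_iff, Fin.val_castSucc, Fin.val_succ] at hmk hml ⊢
      simp only [Fin.lt_def, Fin.le_def] at hil hki
      omega
    have hfX : f ∉ X := by
      simp only [X, mem_iUnion, mem_Iic, not_exists]
      intro k hk hfk
      exact disjoint_left.mp (T.child_pert_disj (hmem k) (hmem j) (hcs.ne (by omega))) hfk hfj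
    obtain ⟨a, -, b, -, hab, ha, hb⟩ := C.exists_ne_mem_vertexSupport (X := X)
      ⟨e, he, mem_biUnion (mem_Iic.mpr le_rfl) hei⟩ ⟨f, hf, hfX⟩
    exact hab ((hshared a ha).trans (hshared b hb).symm)
  rw [hch] at hν
  obtain ⟨i, rfl⟩ := hν
  intro f hf
  obtain ⟨j, hj⟩ := hcover f hf
  rcases lt_trichotomy i j with hij | rfl | hij
  · exact absurd ⟨f, hf, hj⟩ (hcut i j hij hin)
  · exact hj
  · exact absurd hin (hcut j i hij ⟨f, hf, hj⟩)

end SPQRTree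

/-- If an S-node `μ` of the SPQR-tree of the biconnected
graph `G = (V, E_1 ∪ E_2)` is traversable, then every child of `μ` is
traversable. -/
theorem snode_traversable_children {V : Type} (E1 E2 : EdgeSet V)
    (hbic : Biconnected (E1 ∪ E2))
    (T : SPQRTree V (E1 ∪ E2)) (μ : T.Node)
    (hS : T.nodeType μ = SPQRType.S)
    (htrav : NodeTraversable E1 T μ) :
    ∀ ν ∈ T.children μ, NodeTraversable E1 T ν := by
  intro ν hν ⟨C, hin, hout⟩
  have hin' : (C.edgeSet ∩ T.pert μ).Nonempty :=
    hin.mono (inter_subset_inter_right _ (T.child_pert_sub hν))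
  have hout' : (C.edgeSet \ T.pert μ).Nonempty := by
    rw [sdiff_nonempty] at hout ⊢
    exact fun hC => hout (T.edgeSet_subset_pert_child hS C hC hν hin)
  obtain ⟨h1, h2⟩ := T.poles_mem_range_vtx subset_union_left μ C hin' hout'
  exact htrav ⟨⟨C.len, C.len_ge, C.vtx, C.vtx_inj, h1, h2, C.edge_mem⟩, hin', hout'⟩
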